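/- arXiv:1909.09345 — 2 statements merged into one kernel-verified Lean document; each statement's English description precedes it below -/
import Mathlib

section
/- Let p ≥ 1, let λ = (λ₁,…,λ_p) be nonincreasing nonnegative weights with λ₁ > 0, let x ∈ ℝ^p, and fix χ > 0. Define f : [0,∞) → [0,∞) by f(v) = E‖η(x + √v·h; √v·χ, λ) − x‖₂². Then f is continuous at v = 0 with f(0) = 0, and f is strictly increasing on [0, ∞). -/
open MeasureTheory ProbabilityTheory Filter

/-- Standard Gaussian measure `N(0, I_n)` on `ℝⁿ`. -/
noncomputable def stdGaussian (n : ℕ) : Measure (Fin n → ℝ) :=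
  Measure.pi fun _ => gaussianReal 0 1

/-- The nonincreasing rearrangement of the absolute values of the entries of `x`. -/
noncomputable def sortedAbs {n : ℕ} (x : Fin n → ℝ) : Fin n → ℝ :=
  fun i => |x ((Tuple.sort fun j => -|x j|) i)|

/-- The sorted-ℓ1 (SLOPE) norm `‖x‖_λ = ∑ λ_i |x|_(i)`. -/
noncomputable def slopeNorm {n : ℕ} (lam x : Fin n → ℝ) : ℝ :=
  ∑ i, lam i * sortedAbs x i

/-- The SLOPE proximal objective `½‖u − v‖₂² + γ‖v‖_λ`. -/
noncomputable def slopeObj {n : ℕ} (lam : Fin n → ℝ) (γ : ℝ) (u v : Fin n → ℝ) : ℝ :=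
  (1/2) * ∑ i, (u i - v i)^2 + γ * slopeNorm lam v

/-- `v` is a minimizer of the SLOPE proximal objective, i.e. `v = η(u; γ, λ)`
(the minimizer is unique since the objective is strictly convex). -/
def IsSlopeProx {n : ℕ} (lam : Fin n → ℝ) (γ : ℝ) (u v : Fin n → ℝ) : Prop :=
  ∀ w, slopeObj lam γ u v ≤ slopeObj lam γ u w

section SlopeNorm

variable {n : ℕ} {lam : Fin n → ℝ}

lemma sum_mul_abs_comp_perm_le_slopeNorm (hlam : Antitone lam) (x : Fin n → ℝ)
    (π : Equiv.Perm (Fin n)) : ∑ i, lam i * |x (π i)| ≤ slopeNorm lam x := by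
  have hanti : Antitone (sortedAbs x) := fun i j hij =>
    neg_le_neg_iff.mp (Tuple.monotone_sort (fun j => -|x j|) hij)
  have h := (hlam.monovary hanti).sum_mul_comp_perm_le_sum_mul
    (σ := π.trans (Tuple.sort fun j => -|x j|).symm)
  simpa [slopeNorm, sortedAbs] using h

lemma slopeNorm_add_le (hlam : Antitone lam) (hnonneg : ∀ i, 0 ≤ lam i) (a b : Fin n → ℝ) :
    slopeNorm lam (a + b) ≤ slopeNorm lam a + slopeNorm lam b := by
  set π := Tuple.sort fun j => -|(a + b) j|
  calc slopeNorm lam (a + b) = ∑ i, lam i * |a (π i) + b (π i)| := rfl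
    _ ≤ ∑ i, (lam i * |a (π i)| + lam i * |b (π i)|) := by
        gcongr with i
        rw [← mul_add]
        exact mul_le_mul_of_nonneg_left (abs_add_le _ _) (hnonneg i)
    _ ≤ slopeNorm lam a + slopeNorm lam b := by
        rw [Finset.sum_add_distrib]
        exact add_le_add (sum_mul_abs_comp_perm_le_slopeNorm hlam a π)
          (sum_mul_abs_comp_perm_le_slopeNorm hlam b π)

lemma slopeNorm_smul_le (hlam : Antitone lam) {c : ℝ} (hc : 0 ≤ c) (a : Fin n → ℝ) :
    slopeNorm lam (c • a) ≤ c * slopeNorm lam a := by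
  set π := Tuple.sort fun j => -|(c • a) j|
  calc slopeNorm lam (c • a) = ∑ i, lam i * |c * a (π i)| := rfl
    _ = c * ∑ i, lam i * |a (π i)| := by
        rw [Finset.mul_sum]
        refine Finset.sum_congr rfl fun i _ => ?_
        rw [abs_mul, abs_of_nonneg hc]
        ring
    _ ≤ c * slopeNorm lam a := by
        gcongr
        exact sum_mul_abs_comp_perm_le_slopeNorm hlam a π

lemma slopeNorm_le_sum_mul_norm (hnonneg : ∀ i, 0 ≤ lam i) (a : Fin n → ℝ) :
    slopeNorm lam a ≤ (∑ i, lam i) * ‖a‖ := by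
  rw [Finset.sum_mul]
  exact Finset.sum_le_sum fun i _ => mul_le_mul_of_nonneg_left (norm_le_pi_norm a _) (hnonneg i)

end SlopeNorm

namespace IsSlopeProx

variable {n : ℕ} {lam : Fin n → ℝ} {γ : ℝ} {u v : Fin n → ℝ}

/-- The residual `u - v` is a subgradient of `γ‖·‖_λ` at `v`. -/
lemma sum_mul_le (h : IsSlopeProx lam γ u v) (hlam : Antitone lam)
    (hnonneg : ∀ i, 0 ≤ lam i) (hγ : 0 ≤ γ) (w : Fin n → ℝ) :
    ∑ i, (u i - v i) * (w i - v i) ≤ γ * (slopeNorm lam w - slopeNorm lam v) := by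
  set D := ∑ i, (u i - v i) * (w i - v i)
  set B := ∑ i, (w i - v i) ^ 2
  have key : ∀ θ ∈ Set.Ioc (0 : ℝ) 1,
      D ≤ γ * (slopeNorm lam w - slopeNorm lam v) + θ * (B / 2) := by
    rintro θ ⟨h0, h1⟩
    have hconv : slopeNorm lam ((1 - θ) • v + θ • w) ≤
        (1 - θ) * slopeNorm lam v + θ * slopeNorm lam w :=
      (slopeNorm_add_le hlam hnonneg _ _).trans
        (add_le_add (slopeNorm_smul_le hlam (by linarith) v) (slopeNorm_smul_le hlam h0.le w))
    have hsum : ∑ i, (u i - ((1 - θ) • v + θ • w) i) ^ 2 =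
        ∑ i, (u i - v i) ^ 2 - 2 * θ * D + θ ^ 2 * B := by
      simp only [D, B, Finset.mul_sum, ← Finset.sum_sub_distrib, ← Finset.sum_add_distrib]
      refine Finset.sum_congr rfl fun i _ => ?_
      simp only [Pi.add_apply, Pi.smul_apply, smul_eq_mul]
      ring
    have hmin := h ((1 - θ) • v + θ • w)
    rw [slopeObj, slopeObj, hsum] at hmin
    have hγconv := mul_le_mul_of_nonneg_left hconv hγ
    refine le_of_mul_le_mul_left ?_ h0
    linarith
  have hlim : Tendsto (fun θ : ℝ => γ * (slopeNorm lam w - slopeNorm lam v) + θ * (B / 2))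
      (nhdsWithin 0 (Set.Ioi 0)) (nhds (γ * (slopeNorm lam w - slopeNorm lam v))) := by
    have : Continuous fun θ : ℝ =>
        γ * (slopeNorm lam w - slopeNorm lam v) + θ * (B / 2) := by fun_prop
    simpa using (this.tendsto 0).mono_left nhdsWithin_le_nhds
  exact ge_of_tendsto hlim (eventually_of_mem (Ioc_mem_nhdsGT one_pos) key)

lemma norm_sub_le (h : IsSlopeProx lam γ u v) (hlam : Antitone lam)
    (hnonneg : ∀ i, 0 ≤ lam i) (hγ : 0 ≤ γ) : ‖u - v‖ ≤ γ * ∑ i, lam i := by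
  have hΛ : 0 ≤ ∑ i, lam i := Finset.sum_nonneg fun i _ => hnonneg i
  have hsq : ∑ i, (u i - v i) ^ 2 ≤ γ * ((∑ i, lam i) * ‖u - v‖) := by
    have hsub := h.sum_mul_le hlam hnonneg hγ u
    simp only [← pow_two] at hsub
    have hadd := slopeNorm_add_le hlam hnonneg (u - v) v
    rw [sub_add_cancel] at hadd
    have hle := slopeNorm_le_sum_mul_norm hnonneg (u - v)
    exact hsub.trans (mul_le_mul_of_nonneg_left (by linarith) hγ)
  rcases (norm_nonneg (u - v)).eq_or_lt with h0 | h0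
  · rw [← h0]; positivity
  · have hnorm : ‖u - v‖ ^ 2 ≤ ∑ i, (u i - v i) ^ 2 := by
      rw [← Real.le_sqrt h0.le (Finset.sum_nonneg fun i _ => sq_nonneg _)]
      refine (pi_norm_le_iff_of_nonneg (Real.sqrt_nonneg _)).2 fun i => ?_
      exact Real.abs_le_sqrt
        (Finset.single_le_sum (f := fun i => (u i - v i) ^ 2) (fun j _ => sq_nonneg _)
          (Finset.mem_univ i))
    refine le_of_mul_le_mul_right ?_ h0
    nlinarith

lemma abs_sub_le (h : IsSlopeProx lam γ u v) (hlam : Antitone lam)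
    (hnonneg : ∀ i, 0 ≤ lam i) (hγ : 0 ≤ γ) (i : Fin n) : |u i - v i| ≤ γ * ∑ i, lam i :=
  (norm_le_pi_norm (u - v) i).trans (h.norm_sub_le hlam hnonneg hγ)

/-- The proximal map is nonexpansive. -/
lemma sum_sq_sub_le {u' v' : Fin n → ℝ} (h : IsSlopeProx lam γ u v)
    (h' : IsSlopeProx lam γ u' v') (hlam : Antitone lam) (hnonneg : ∀ i, 0 ≤ lam i)
    (hγ : 0 ≤ γ) : ∑ i, (v i - v' i) ^ 2 ≤ ∑ i, (u i - u' i) ^ 2 := by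
  have h₁ := h.sum_mul_le hlam hnonneg hγ v'
  have h₂ := h'.sum_mul_le hlam hnonneg hγ v
  have hpt : ∑ i, (v i - v' i) ^ 2 ≤ ∑ i, ((u i - u' i) ^ 2 +
      2 * ((u i - v i) * (v' i - v i)) + 2 * ((u' i - v' i) * (v i - v' i))) :=
    Finset.sum_le_sum fun i _ => by nlinarith [sq_nonneg (u i - u' i - (v i - v' i))]
  rw [Finset.sum_add_distrib, Finset.sum_add_distrib, ← Finset.mul_sum, ← Finset.mul_sum] at hpt
  linarith

lemma continuous {φ : (Fin n → ℝ) → (Fin n → ℝ)} (h : ∀ u, IsSlopeProx lam γ u (φ u))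
    (hlam : Antitone lam) (hnonneg : ∀ i, 0 ≤ lam i) (hγ : 0 ≤ γ) : Continuous φ := by
  refine continuous_pi fun i => continuous_iff_continuousAt.2 fun u₀ => ?_
  rw [ContinuousAt, tendsto_iff_norm_sub_tendsto_zero]
  have hlim : Tendsto (fun u : Fin n → ℝ => Real.sqrt (∑ i, (u i - u₀ i) ^ 2)) (nhds u₀)
      (nhds 0) := by
    have : Continuous fun u : Fin n → ℝ => Real.sqrt (∑ i, (u i - u₀ i) ^ 2) := by fun_prop
    simpa using this.tendsto u₀
  refine squeeze_zero (fun u => norm_nonneg _) (fun u => ?_) hlim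
  refine Real.abs_le_sqrt (le_trans ?_ ((h u).sum_sq_sub_le (h u₀) hlam hnonneg hγ))
  exact Finset.single_le_sum (f := fun i => (φ u i - φ u₀ i) ^ 2) (fun j _ => sq_nonneg _)
    (Finset.mem_univ i)

variable {x h a b : Fin n → ℝ} {χ s t : ℝ}

lemma mul_sum_sq_add_le (hs : 0 < s) (ht : 0 < t) (hχ : 0 ≤ χ)
    (ha : IsSlopeProx lam (s * χ) (fun j => x j + s * h j) a)
    (hb : IsSlopeProx lam (t * χ) (fun j => x j + t * h j) b)
    (hlam : Antitone lam) (hnonneg : ∀ i, 0 ≤ lam i) :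
    t * ∑ i, (a i - x i) ^ 2 + s * ∑ i, (b i - x i) ^ 2 ≤
      (s + t) * ∑ i, (a i - x i) * (b i - x i) := by
  have h₁ := mul_le_mul_of_nonneg_left
    (ha.sum_mul_le hlam hnonneg (by positivity) b) ht.le
  have h₂ := mul_le_mul_of_nonneg_left
    (hb.sum_mul_le hlam hnonneg (by positivity) a) hs.le
  have hid : t * ∑ i, (a i - x i) ^ 2 + s * ∑ i, (b i - x i) ^ 2 =
      (s + t) * ∑ i, (a i - x i) * (b i - x i) +
      (t * ∑ i, (x i + s * h i - a i) * (b i - a i) +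
        s * ∑ i, (x i + t * h i - b i) * (a i - b i)) := by
    simp only [Finset.mul_sum, ← Finset.sum_add_distrib]
    exact Finset.sum_congr rfl fun i _ => by ring
  linarith

lemma sum_sq_sub_mono (hs : 0 < s) (hst : s < t) (hχ : 0 ≤ χ)
    (ha : IsSlopeProx lam (s * χ) (fun j => x j + s * h j) a)
    (hb : IsSlopeProx lam (t * χ) (fun j => x j + t * h j) b)
    (hlam : Antitone lam) (hnonneg : ∀ i, 0 ≤ lam i) :
    ∑ i, (a i - x i) ^ 2 ≤ ∑ i, (b i - x i) ^ 2 ∧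
      (∑ i, (a i - x i) ^ 2 = ∑ i, (b i - x i) ^ 2 → a = b) := by
  have hkey := mul_sum_sq_add_le hs (hs.trans hst) hχ ha hb hlam hnonneg
  have hdiff : ∑ i, (a i - b i) ^ 2 = ∑ i, (a i - x i) ^ 2 + ∑ i, (b i - x i) ^ 2 -
      2 * ∑ i, (a i - x i) * (b i - x i) := by
    simp only [Finset.mul_sum, ← Finset.sum_add_distrib, ← Finset.sum_sub_distrib]
    exact Finset.sum_congr rfl fun i _ => by ring
  have hpos : 0 ≤ ∑ i, (a i - b i) ^ 2 := Finset.sum_nonneg fun i _ => sq_nonneg _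
  set A := ∑ i, (a i - x i) ^ 2
  set B := ∑ i, (b i - x i) ^ 2
  set P := ∑ i, (a i - x i) * (b i - x i)
  refine ⟨?_, fun hAB => ?_⟩
  · refine le_of_mul_le_mul_left ?_ (sub_pos.2 hst)
    nlinarith
  · have hzero : ∑ i, (a i - b i) ^ 2 = 0 := by
      refine le_antisymm ?_ hpos
      have hBP : B ≤ P := by
        refine le_of_mul_le_mul_left ?_ (by linarith : 0 < s + t)
        rw [hAB] at hkey
        linarith
      linarith
    ext i
    have := (Finset.sum_eq_zero_iff_of_nonneg fun i _ => sq_nonneg _).1 hzero i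
      (Finset.mem_univ i)
    exact sub_eq_zero.1 (pow_eq_zero_iff two_ne_zero |>.1 this)

lemma sum_sq_sub_lt (hs : 0 < s) (hst : s < t) (hχ : 0 ≤ χ)
    (ha : IsSlopeProx lam (s * χ) (fun j => x j + s * h j) a)
    (hb : IsSlopeProx lam (t * χ) (fun j => x j + t * h j) b)
    (hlam : Antitone lam) (hnonneg : ∀ i, 0 ≤ lam i) {i : Fin n}
    (hi : (s + t) * (χ * ∑ i, lam i) / (t - s) < h i) :
    ∑ i, (a i - x i) ^ 2 < ∑ i, (b i - x i) ^ 2 := by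
  obtain ⟨hle, heq⟩ := sum_sq_sub_mono hs hst hχ ha hb hlam hnonneg
  refine lt_of_le_of_ne hle fun hab => ?_
  obtain rfl := heq hab
  have h₁ := abs_le.1 (ha.abs_sub_le hlam hnonneg (by positivity) i)
  have h₂ := abs_le.1 (hb.abs_sub_le hlam hnonneg (mul_nonneg (hs.trans hst).le hχ) i)
  rw [div_lt_iff₀ (sub_pos.2 hst)] at hi
  linarith [h₁.1, h₂.2]

lemma sum_sq_sub_le_mul (hs : 0 ≤ s) (hχ : 0 ≤ χ)
    (ha : IsSlopeProx lam (s * χ) (fun j => x j + s * h j) a)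
    (hlam : Antitone lam) (hnonneg : ∀ i, 0 ≤ lam i) :
    ∑ i, (a i - x i) ^ 2 ≤ s ^ 2 * ∑ i, (2 * h i ^ 2 + 2 * (χ * ∑ i, lam i) ^ 2) := by
  rw [Finset.mul_sum]
  refine Finset.sum_le_sum fun i _ => ?_
  have hb := sq_le_sq' (abs_le.1 (ha.abs_sub_le hlam hnonneg (by positivity) i)).1
    (abs_le.1 (ha.abs_sub_le hlam hnonneg (by positivity) i)).2
  nlinarith [sq_nonneg (s * h i + (x i + s * h i - a i))]

end IsSlopeProx

instance (n : ℕ) : IsProbabilityMeasure (_root_.stdGaussian n) := by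
  unfold _root_.stdGaussian; infer_instance

instance (n : ℕ) : (_root_.stdGaussian n).IsOpenPosMeasure := by
  have : (gaussianReal 0 1).IsOpenPosMeasure :=
    (gaussianReal_absolutelyContinuous' 0 one_ne_zero).isOpenPosMeasure
  unfold _root_.stdGaussian; infer_instance

lemma integrable_sq_eval_stdGaussian {n : ℕ} (i : Fin n) :
    Integrable (fun h : Fin n → ℝ => h i ^ 2) (_root_.stdGaussian n) :=
  integrable_comp_eval (μ := fun _ : Fin n => gaussianReal 0 1) (i := i)
    (f := fun y : ℝ => y ^ 2) (memLp_id_gaussianReal 2).integrable_sq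

/-- for fixed `χ > 0`, the map
`f(v) = E‖η(x + √v·h; √v·χ) − x‖₂²` satisfies `f(0) = 0`, is continuous at `0`
(within `[0,∞)`), and is strictly increasing on `[0,∞)`. -/
theorem slope_mse_function_increasing
    (p : ℕ) (hp : 1 ≤ p)
    (lam : Fin p → ℝ)
    (hmono : ∀ i j : Fin p, i ≤ j → lam j ≤ lam i)
    (hnonneg : ∀ i, 0 ≤ lam i)
    (hlam1 : 0 < lam ⟨0, hp⟩)
    (x : Fin p → ℝ)
    (χ : ℝ) (hχ : 0 < χ)
    (η : ℝ → (Fin p → ℝ) → (Fin p → ℝ))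
    (hη : ∀ γ u, 0 ≤ γ → IsSlopeProx lam γ u (η γ u))
    (f : ℝ → ℝ)
    (hf : ∀ v : ℝ, f v = ∫ h,
      (∑ i, (η (Real.sqrt v * χ) (fun j => x j + Real.sqrt v * h j) i - x i) ^ 2)
        ∂ stdGaussian p) :
    f 0 = 0 ∧ ContinuousWithinAt f (Set.Ici 0) 0 ∧ StrictMonoOn f (Set.Ici 0) := by
  have hlam : Antitone lam := fun i j hij => hmono i j hij
  set F : ℝ → (Fin p → ℝ) → ℝ := fun v h =>
    ∑ i, (η (Real.sqrt v * χ) (fun j => x j + Real.sqrt v * h j) i - x i) ^ 2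
  set G : (Fin p → ℝ) → ℝ := fun h => ∑ i, (2 * h i ^ 2 + 2 * (χ * ∑ i, lam i) ^ 2)
  have hprox : ∀ (v : ℝ) (h : Fin p → ℝ), IsSlopeProx lam (Real.sqrt v * χ) (fun j => x j + Real.sqrt v * h j)
      (η (Real.sqrt v * χ) (fun j => x j + Real.sqrt v * h j)) :=
    fun v h => hη _ _ (by positivity)
  have hF0 : ∀ v h, 0 ≤ F v h := fun v h => Finset.sum_nonneg fun i _ => sq_nonneg _
  have hFG : ∀ v h, 0 ≤ v → F v h ≤ v * G h := fun v h hv => by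
    have := (hprox v h).sum_sq_sub_le_mul (Real.sqrt_nonneg v) hχ.le hlam hnonneg
    rwa [Real.sq_sqrt hv] at this
  have hG : Integrable G (_root_.stdGaussian p) :=
    integrable_finsetSum _ fun i _ =>
      ((integrable_sq_eval_stdGaussian i).const_mul 2).add (integrable_const _)
  have hFcont : ∀ v, Continuous (F v) := fun v => by
    have hc : Continuous (η (Real.sqrt v * χ)) :=
      IsSlopeProx.continuous (fun u => hη _ u (by positivity)) hlam hnonneg (by positivity)
    fun_prop
  have hFint : ∀ v, 0 ≤ v → Integrable (F v) (_root_.stdGaussian p) := fun v hv =>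
    (hG.const_mul v).mono' (hFcont v).aestronglyMeasurable
      (ae_of_all _ fun h => by rw [Real.norm_of_nonneg (hF0 v h)]; exact hFG v h hv)
  have hf_nonneg : ∀ v, 0 ≤ f v := fun v => by
    rw [hf]; exact integral_nonneg (hF0 v)
  have hf_le : ∀ v, 0 ≤ v → f v ≤ v * ∫ h, G h ∂(_root_.stdGaussian p) := fun v hv => by
    rw [hf, ← integral_const_mul]
    exact integral_mono (hFint v hv) (hG.const_mul v) fun h => hFG v h hv
  have hf_zero : f 0 = 0 := le_antisymm (by simpa using hf_le 0 le_rfl) (hf_nonneg 0)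
  have hf_lt : ∀ s t, 0 < s → s < t → f s < f t := fun s t hs hst => by
    have hs' := Real.sqrt_pos.2 hs
    have hst' := Real.sqrt_lt_sqrt hs.le hst
    rw [hf, hf]
    have hle : F s ≤ F t := fun h =>
      (IsSlopeProx.sum_sq_sub_mono hs' hst' hχ.le (hprox s h) (hprox t h) hlam hnonneg).1
    have hFs := hFint s hs.le
    have hFt := hFint t (hs.trans hst).le
    refine lt_of_le_of_ne (integral_mono hFs hFt hle) fun heq => ?_
    have hae := (integral_eq_iff_of_ae_le hFs hFt (ae_of_all _ hle)).1 heq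
    set C := (Real.sqrt s + Real.sqrt t) * (χ * ∑ i, lam i) / (Real.sqrt t - Real.sqrt s)
    have hopen : IsOpen {h : Fin p → ℝ | C < h ⟨0, hp⟩} :=
      isOpen_lt continuous_const (continuous_apply _)
    have hne : {h : Fin p → ℝ | C < h ⟨0, hp⟩}.Nonempty := ⟨fun _ => C + 1, lt_add_one C⟩
    refine (hopen.measure_pos (_root_.stdGaussian p) hne).ne'
      (measure_mono_null (fun h hh => ?_) (ae_iff.1 hae))
    exact (IsSlopeProx.sum_sq_sub_lt hs' hst' hχ.le (hprox s h) (hprox t h) hlam hnonneg hh).ne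
  refine ⟨hf_zero, ?_, fun s hs t _ hst => ?_⟩
  · rw [ContinuousWithinAt, hf_zero]
    have hlim : Tendsto (fun v : ℝ => v * ∫ h, G h ∂(_root_.stdGaussian p))
        (nhdsWithin 0 (Set.Ici 0)) (nhds 0) := by
      have : Continuous fun v : ℝ => v * ∫ h, G h ∂(_root_.stdGaussian p) := by fun_prop
      simpa using (this.tendsto 0).mono_left nhdsWithin_le_nhds
    exact tendsto_of_tendsto_of_tendsto_of_le_of_le' tendsto_const_nhds hlim
      (Eventually.of_forall hf_nonneg) (eventually_mem_nhdsWithin.mono fun v hv => hf_le v hv)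
  · rcases (Set.mem_Ici.1 hs).eq_or_lt with rfl | h0
    · rw [hf_zero]
      exact (hf_nonneg (t / 2)).trans_lt (hf_lt _ _ (half_pos hst) (half_lt_self hst))
    · exact hf_lt s t h0 hst
end

section
/- Let p ≥ 1, let λ = (λ₁,…,λ_p) be nonincreasing nonnegative weights with λ₁ > 0, and let x ∈ ℝ^p have exactly k nonzero entries (1 ≤ k ≤ p) whose absolute values are pairwise distinct. Then lim_{v → 0⁺} (1/p) inf_{χ>0} E‖η(x/√v + h; χ, λ) − x/√v‖₂² = M_λ. -/
open MeasureTheory ProbabilityTheory Filter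

section SlopeNorm

variable {n : ℕ} {lam : Fin n → ℝ}

lemma antitone_sortedAbs (x : Fin n → ℝ) : Antitone (sortedAbs x) := by
  intro i j hij
  have := Tuple.monotone_sort (fun j => -|x j|) hij
  simpa [sortedAbs] using this

lemma sum_mul_abs_perm_le (hlam : Antitone lam) (x : Fin n → ℝ) (σ τ : Equiv.Perm (Fin n))
    (hσ : Antitone fun i => |x (σ i)|) :
    ∑ i, lam i * |x (τ i)| ≤ ∑ i, lam i * |x (σ i)| := by
  have hv : Monovary lam fun i => |x (σ i)| := hlam.monovary hσ
  simpa using hv.sum_mul_comp_perm_le_sum_mul (σ := τ.trans σ.symm)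

lemma slopeNorm_eq_of_antitone (hlam : Antitone lam) (x : Fin n → ℝ) (σ : Equiv.Perm (Fin n))
    (hσ : Antitone fun i => |x (σ i)|) : slopeNorm lam x = ∑ i, lam i * |x (σ i)| :=
  le_antisymm (sum_mul_abs_perm_le hlam x σ _ hσ)
    (sum_mul_abs_perm_le hlam x _ σ (antitone_sortedAbs x))

lemma sum_mul_abs_perm_le_slopeNorm (hlam : Antitone lam) (x : Fin n → ℝ)
    (τ : Equiv.Perm (Fin n)) : ∑ i, lam i * |x (τ i)| ≤ slopeNorm lam x :=
  sum_mul_abs_perm_le hlam x _ τ (antitone_sortedAbs x)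

lemma slopeNorm_add_smul_sub_le (hlam : Antitone lam) (h0 : ∀ i, 0 ≤ lam i) (v w : Fin n → ℝ)
    {s : ℝ} (hs : 0 ≤ s) (hs1 : s ≤ 1) :
    slopeNorm lam (fun i => v i + s * (w i - v i)) ≤
      (1 - s) * slopeNorm lam v + s * slopeNorm lam w := by
  set z : Fin n → ℝ := fun i => v i + s * (w i - v i) with hz
  set τ := Tuple.sort fun j => -|z j|
  have h1 := sum_mul_abs_perm_le_slopeNorm hlam v τ
  have h2 := sum_mul_abs_perm_le_slopeNorm hlam w τ
  have h3 : slopeNorm lam z ≤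
      (1 - s) * ∑ i, lam i * |v (τ i)| + s * ∑ i, lam i * |w (τ i)| := by
    rw [Finset.mul_sum, Finset.mul_sum, ← Finset.sum_add_distrib]
    refine Finset.sum_le_sum fun i _ => ?_
    have h4 : |z (τ i)| ≤ (1 - s) * |v (τ i)| + s * |w (τ i)| := by
      have h5 : z (τ i) = (1 - s) * v (τ i) + s * w (τ i) := by simp only [hz]; ring
      rw [h5]
      refine (abs_add_le _ _).trans ?_
      rw [abs_mul, abs_mul, abs_of_nonneg hs, abs_of_nonneg (sub_nonneg.2 hs1)]
    have := mul_le_mul_of_nonneg_left h4 (h0 i)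
    calc _ ≤ _ := this
      _ = _ := by ring
  have := mul_le_mul_of_nonneg_left h1 (sub_nonneg.2 hs1)
  have := mul_le_mul_of_nonneg_left h2 hs
  linarith

lemma slopeNorm_sub_sq_le (hlam : Antitone lam) (h0 : ∀ i, 0 ≤ lam i) (a b : Fin n → ℝ)
    (hab : slopeNorm lam b ≤ slopeNorm lam a) :
    (slopeNorm lam a - slopeNorm lam b) ^ 2 ≤ (∑ i, lam i ^ 2) * ∑ i, (a i - b i) ^ 2 := by
  set τ := Tuple.sort fun j => -|a j|
  have h1 := sum_mul_abs_perm_le_slopeNorm hlam b τ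
  have h2 : slopeNorm lam a - slopeNorm lam b ≤ ∑ i, lam i * |a (τ i) - b (τ i)| := by
    have : slopeNorm lam a = ∑ i, lam i * |a (τ i)| := rfl
    have h3 : ∑ i, lam i * |a (τ i)| - ∑ i, lam i * |b (τ i)| ≤
        ∑ i, lam i * |a (τ i) - b (τ i)| := by
      rw [← Finset.sum_sub_distrib]
      refine Finset.sum_le_sum fun i _ => ?_
      rw [← mul_sub]
      exact mul_le_mul_of_nonneg_left (abs_sub_abs_le_abs_sub _ _) (h0 i)
    linarith
  calc _ ≤ (∑ i, lam i * |a (τ i) - b (τ i)|) ^ 2 :=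
        pow_le_pow_left₀ (sub_nonneg.2 hab) h2 2
    _ ≤ _ := Finset.sum_mul_sq_le_sq_mul_sq _ _ _
    _ = _ := by
      simp only [sq_abs]
      rw [Equiv.sum_comp τ fun i => (a i - b i) ^ 2]

/-- The variational inequality characterizing the proximal point. -/
lemma IsSlopeProx.inner_le (hlam : Antitone lam) (h0 : ∀ i, 0 ≤ lam i) {γ : ℝ} (hγ : 0 ≤ γ)
    {u v : Fin n → ℝ} (hv : IsSlopeProx lam γ u v) (w : Fin n → ℝ) :
    ∑ i, (u i - v i) * (w i - v i) ≤ γ * (slopeNorm lam w - slopeNorm lam v) := by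
  by_contra! hlt
  set A := ∑ i, (u i - v i) * (w i - v i) with hA
  set B := γ * (slopeNorm lam w - slopeNorm lam v) with hB
  set D := ∑ i, (w i - v i) ^ 2 with hD
  have hD0 : 0 ≤ D := Finset.sum_nonneg fun i _ => sq_nonneg _
  have hpos : 0 < A - B + D := by linarith
  have key : ∀ s : ℝ, 0 < s → s ≤ 1 → A - B ≤ s * D / 2 := by
    intro s hs hs1
    have h1 := hv fun i => v i + s * (w i - v i)
    have h2 := mul_le_mul_of_nonneg_left (slopeNorm_add_smul_sub_le hlam h0 v w hs.le hs1) hγ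
    have h3 : ∑ i, (u i - (v i + s * (w i - v i))) ^ 2 =
        ∑ i, (u i - v i) ^ 2 - 2 * s * A + s ^ 2 * D := by
      rw [hA, hD, Finset.mul_sum, Finset.mul_sum, ← Finset.sum_sub_distrib,
        ← Finset.sum_add_distrib]
      exact Finset.sum_congr rfl fun i _ => by ring
    simp only [slopeObj, h3] at h1
    have h4 : s * (A - B) ≤ s * (s * D / 2) := by
      rw [hB]
      nlinarith
    exact le_of_mul_le_mul_left h4 hs
  have h5 := key ((A - B) / (A - B + D)) (div_pos (by linarith) hpos)
    ((div_le_one hpos).2 (by linarith))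
  have h6 : (A - B) * (A - B + D) ≤ (A - B) * D / 2 := by
    calc _ ≤ ((A - B) / (A - B + D) * D / 2) * (A - B + D) :=
          mul_le_mul_of_nonneg_right h5 hpos.le
      _ = _ := by field_simp
  nlinarith

lemma IsSlopeProx.sum_sq_sub_le_s8 (hlam : Antitone lam) (h0 : ∀ i, 0 ≤ lam i) {γ : ℝ} (hγ : 0 ≤ γ)
    {u v u' v' : Fin n → ℝ} (hv : IsSlopeProx lam γ u v) (hv' : IsSlopeProx lam γ u' v') :
    ∑ i, (v i - v' i) ^ 2 ≤ ∑ i, (u i - u' i) ^ 2 := by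
  have h1 := hv.inner_le hlam h0 hγ v'
  have h2 := hv'.inner_le hlam h0 hγ v
  have h3 : ∑ i, (u i - v i) * (v' i - v i) + ∑ i, (u' i - v' i) * (v i - v' i) =
      (1 / 2) * ∑ i, (v i - v' i) ^ 2 - (1 / 2) * ∑ i, (u i - u' i) ^ 2
        + (1 / 2) * ∑ i, ((v i - v' i) - (u i - u' i)) ^ 2 := by
    simp only [Finset.mul_sum]
    rw [← Finset.sum_add_distrib, ← Finset.sum_sub_distrib, ← Finset.sum_add_distrib]
    exact Finset.sum_congr rfl fun i _ => by ring
  have h4 : 0 ≤ ∑ i, ((v i - v' i) - (u i - u' i)) ^ 2 :=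
    Finset.sum_nonneg fun i _ => sq_nonneg _
  linarith

lemma IsSlopeProx.eq (hlam : Antitone lam) (h0 : ∀ i, 0 ≤ lam i) {γ : ℝ} (hγ : 0 ≤ γ)
    {u v v' : Fin n → ℝ} (hv : IsSlopeProx lam γ u v) (hv' : IsSlopeProx lam γ u v') :
    v = v' := by
  have h := hv.sum_sq_sub_le_s8 hlam h0 hγ hv'
  simp only [sub_self, ne_eq, OfNat.ofNat_ne_zero, not_false_eq_true, zero_pow,
    Finset.sum_const_zero] at h
  have h2 := (Finset.sum_eq_zero_iff_of_nonneg fun i _ => sq_nonneg (v i - v' i)).1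
    (le_antisymm h (Finset.sum_nonneg fun i _ => sq_nonneg _))
  funext i
  have := h2 i (Finset.mem_univ i)
  exact sub_eq_zero.1 (pow_eq_zero_iff two_ne_zero |>.1 this)

lemma IsSlopeProx.slopeNorm_le {γ γ' : ℝ} (hγ : γ < γ') {u v v' : Fin n → ℝ}
    (hv : IsSlopeProx lam γ u v) (hv' : IsSlopeProx lam γ' u v') :
    slopeNorm lam v' ≤ slopeNorm lam v := by
  have h1 := hv v'
  have h2 := hv' v
  simp only [slopeObj] at h1 h2
  nlinarith

/-- The residual of the proximal map grows with the regularization level. -/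
lemma IsSlopeProx.sum_sq_residual_mono {γ γ' : ℝ} (h0 : 0 ≤ γ) (hγ : γ < γ') {u v v' : Fin n → ℝ}
    (hv : IsSlopeProx lam γ u v) (hv' : IsSlopeProx lam γ' u v') :
    ∑ i, (u i - v i) ^ 2 ≤ ∑ i, (u i - v' i) ^ 2 := by
  have h1 := hv v'
  have h2 := mul_le_mul_of_nonneg_left (hv.slopeNorm_le hγ hv') h0
  simp only [slopeObj] at h1
  linarith

lemma le_of_le_mul_of_sq_le {D c s L : ℝ} (hD : 0 ≤ D) (hL : 0 ≤ L) (h1 : D ≤ c * s)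
    (h2 : s ^ 2 ≤ L * D) : D ≤ c ^ 2 * L := by
  rcases hD.eq_or_lt with h | h
  · rw [← h]; positivity
  · have h3 : D ^ 2 ≤ c ^ 2 * (L * D) := by
      calc D ^ 2 ≤ (c * s) ^ 2 := pow_le_pow_left₀ hD h1 2
        _ = c ^ 2 * s ^ 2 := by ring
        _ ≤ _ := by gcongr
    nlinarith

lemma IsSlopeProx.sum_sq_sub_le_of_lt (hlam : Antitone lam) (h0 : ∀ i, 0 ≤ lam i) {γ γ' : ℝ}
    (hγ0 : 0 ≤ γ) (hγ : γ < γ') {u v v' : Fin n → ℝ} (hv : IsSlopeProx lam γ u v)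
    (hv' : IsSlopeProx lam γ' u v') :
    ∑ i, (v i - v' i) ^ 2 ≤ (γ - γ') ^ 2 * ∑ i, lam i ^ 2 := by
  have h1 := hv.inner_le hlam h0 hγ0 v'
  have h2 := hv'.inner_le hlam h0 (hγ0.trans hγ.le) v
  have h3 : ∑ i, (u i - v i) * (v' i - v i) + ∑ i, (u i - v' i) * (v i - v' i) =
      ∑ i, (v i - v' i) ^ 2 := by
    rw [← Finset.sum_add_distrib]
    exact Finset.sum_congr rfl fun i _ => by ring
  have h4 := slopeNorm_sub_sq_le hlam h0 v v' (hv.slopeNorm_le hγ hv')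
  have h5 := le_of_le_mul_of_sq_le (c := γ' - γ) (Finset.sum_nonneg fun i _ => sq_nonneg _)
    (Finset.sum_nonneg fun i _ => sq_nonneg _) (by linarith) h4
  linarith [sub_sq_comm γ γ' ▸ h5]

lemma IsSlopeProx.sum_sq_sub_le_param (hlam : Antitone lam) (h0 : ∀ i, 0 ≤ lam i) {γ γ' : ℝ}
    (hγ : 0 ≤ γ) (hγ' : 0 ≤ γ') {u v v' : Fin n → ℝ} (hv : IsSlopeProx lam γ u v)
    (hv' : IsSlopeProx lam γ' u v') :
    ∑ i, (v i - v' i) ^ 2 ≤ (γ - γ') ^ 2 * ∑ i, lam i ^ 2 := by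
  rcases lt_trichotomy γ γ' with h | h | h
  · exact hv.sum_sq_sub_le_of_lt hlam h0 hγ h hv'
  · subst h
    simp [hv.eq hlam h0 hγ hv']
  · have := hv'.sum_sq_sub_le_of_lt hlam h0 hγ' h hv
    rw [sub_sq_comm γ γ']
    simpa only [sub_sq_comm (v _) (v' _)] using this

lemma IsSlopeProx.sum_sq_residual_le (hlam : Antitone lam) (h0 : ∀ i, 0 ≤ lam i) {γ : ℝ}
    (hγ : 0 ≤ γ) {u v : Fin n → ℝ} (hv : IsSlopeProx lam γ u v) :
    ∑ i, (u i - v i) ^ 2 ≤ γ ^ 2 * ∑ i, lam i ^ 2 := by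
  have h : IsSlopeProx lam 0 u u := by
    intro w
    simp only [slopeObj, sub_self, zero_mul, add_zero]
    simpa using Finset.sum_nonneg fun i _ => sq_nonneg (u i - w i)
  simpa using h.sum_sq_sub_le_param hlam h0 le_rfl hγ hv

lemma continuous_of_isSlopeProx (hlam : Antitone lam) (h0 : ∀ i, 0 ≤ lam i) {γ : ℝ}
    (hγ : 0 ≤ γ) {f : (Fin n → ℝ) → Fin n → ℝ} (hf : ∀ u, IsSlopeProx lam γ u (f u)) :
    Continuous f := by
  rw [continuous_iff_continuousAt]
  intro u₀
  refine tendsto_pi_nhds.2 fun i => ?_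
  rw [tendsto_iff_dist_tendsto_zero]
  have hc : Tendsto (fun u : Fin n → ℝ => √(∑ j, (u j - u₀ j) ^ 2)) (nhds u₀) (nhds 0) := by
    have : Continuous fun u : Fin n → ℝ => √(∑ j, (u j - u₀ j) ^ 2) := by fun_prop
    simpa using this.tendsto u₀
  refine squeeze_zero (fun _ => dist_nonneg) (fun u => ?_) hc
  rw [Real.dist_eq]
  refine Real.abs_le_sqrt (le_trans ?_ ((hf u).sum_sq_sub_le_s8 hlam h0 hγ (hf u₀)))
  exact Finset.single_le_sum (f := fun j => (f u j - f u₀ j) ^ 2) (fun j _ => sq_nonneg _)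
    (Finset.mem_univ i)

end SlopeNorm

section Decoupling

variable {k q : ℕ} {lam : Fin (k + q) → ℝ}

lemma sum_add_slopeNorm_natAdd_le (hlam : Antitone lam) (h0 : ∀ i, 0 ≤ lam i)
    (ρ : Equiv.Perm (Fin (k + q))) {s : Fin k → ℝ} (hs : ∀ i, s i ^ 2 = 1)
    (w : Fin (k + q) → ℝ) :
    ∑ i, lam (Fin.castAdd q i) * (s i * w (ρ (Fin.castAdd q i)))
      + slopeNorm (fun j => lam (Fin.natAdd k j)) (fun j => w (ρ (Fin.natAdd k j)))
      ≤ slopeNorm lam w := by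
  set τ : Equiv.Perm (Fin q) := Tuple.sort fun j => -|w (ρ (Fin.natAdd k j))|
  have h := sum_mul_abs_perm_le_slopeNorm hlam w
    ((finSumFinEquiv.symm.trans
      ((Equiv.sumCongr (Equiv.refl (Fin k)) τ).trans finSumFinEquiv)).trans ρ)
  rw [Fin.sum_univ_add] at h
  simp only [Equiv.trans_apply, finSumFinEquiv_symm_apply_castAdd,
    finSumFinEquiv_symm_apply_natAdd, Equiv.sumCongr_apply, Sum.map_inl, Sum.map_inr,
    Equiv.refl_apply, finSumFinEquiv_apply_left, finSumFinEquiv_apply_right] at h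
  refine le_trans (add_le_add (Finset.sum_le_sum fun i _ => ?_) le_rfl) h
  refine mul_le_mul_of_nonneg_left ?_ (h0 _)
  have h1 : |s i| = 1 := by
    rw [← sq_eq_sq₀ (abs_nonneg _) zero_le_one, sq_abs, hs, one_pow]
  calc _ ≤ |s i * w (ρ (Fin.castAdd q i))| := le_abs_self _
    _ = _ := by rw [abs_mul, h1, one_mul]

lemma slopeNorm_append (hlam : Antitone lam) (ρ : Equiv.Perm (Fin (k + q))) {V : Fin k → ℝ}
    {W : Fin q → ℝ} (hV : Antitone fun i => |V i|) (hVW : ∀ i j, |W j| ≤ |V i|) :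
    slopeNorm lam (fun m => Fin.append V W (ρ.symm m)) =
      ∑ i, lam (Fin.castAdd q i) * |V i| + slopeNorm (fun j => lam (Fin.natAdd k j)) W := by
  set τ : Equiv.Perm (Fin q) := Tuple.sort fun j => -|W j|
  rw [slopeNorm_eq_of_antitone hlam _ ((finSumFinEquiv.symm.trans
      ((Equiv.sumCongr (Equiv.refl (Fin k)) τ).trans finSumFinEquiv)).trans ρ), Fin.sum_univ_add]
  · simp only [Equiv.trans_apply, finSumFinEquiv_symm_apply_castAdd,
      finSumFinEquiv_symm_apply_natAdd, Equiv.sumCongr_apply, Sum.map_inl, Sum.map_inr,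
      Equiv.refl_apply, finSumFinEquiv_apply_left, finSumFinEquiv_apply_right,
      Equiv.symm_apply_apply, Fin.append_left, Fin.append_right]
    rfl
  · intro a b hab
    induction a using Fin.addCases with
    | left i =>
      induction b using Fin.addCases with
      | left j => simpa using hV (show i ≤ j from hab)
      | right j => simpa using hVW i (τ j)
    | right i =>
      induction b using Fin.addCases with
      | left j =>
        have := j.isLt
        simp only [Fin.le_def, Fin.val_natAdd, Fin.val_castAdd] at hab
        omega
      | right j =>
        have : |W (τ j)| ≤ |W (τ i)| := antitone_sortedAbs W (by simpa using hab)
        simpa using this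

/-- When the first block of coordinates dominates the rest after soft-thresholding by `γ λ_i`,
the proximal problem splits into independent problems on the two blocks. -/
lemma isSlopeProx_append (hlam : Antitone lam) (h0 : ∀ i, 0 ≤ lam i)
    (ρ : Equiv.Perm (Fin (k + q))) {s : Fin k → ℝ} (hs : ∀ i, s i ^ 2 = 1) {γ : ℝ} (hγ : 0 ≤ γ)
    {u : Fin (k + q) → ℝ} {W : Fin q → ℝ}
    (hW : IsSlopeProx (fun j => lam (Fin.natAdd k j)) γ (fun j => u (ρ (Fin.natAdd k j))) W)
    {c : Fin k → ℝ} (hc : ∀ i, s i * u (ρ (Fin.castAdd q i)) - γ * lam (Fin.castAdd q i) = c i)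
    (hc0 : ∀ i, 0 ≤ c i) (hcanti : Antitone c) (hcW : ∀ i j, |W j| ≤ c i) :
    IsSlopeProx lam γ u (fun m => Fin.append (fun i => s i * c i) W (ρ.symm m)) := by
  have habs : ∀ i, |s i * c i| = c i := fun i => by
    rw [← sq_eq_sq₀ (abs_nonneg _) (hc0 i), sq_abs, mul_pow, hs, one_mul]
  intro w
  have hw := hW fun j => w (ρ (Fin.natAdd k j))
  have h1 := mul_le_mul_of_nonneg_left (sum_add_slopeNorm_natAdd_le hlam h0 ρ hs w) hγ
  have h2 := slopeNorm_append hlam ρ (V := fun i => s i * c i) (W := W)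
    (by simpa only [habs] using hcanti) (by simpa only [habs] using hcW)
  simp only [habs] at h2
  simp only [slopeObj] at hw ⊢
  rw [h2, ← Equiv.sum_comp ρ, ← Equiv.sum_comp ρ fun i => (u i - w i) ^ 2, Fin.sum_univ_add,
    Fin.sum_univ_add]
  simp only [Equiv.symm_apply_apply, Fin.append_left, Fin.append_right]
  have h3 : ∑ i, ((1 / 2) * (u (ρ (Fin.castAdd q i)) - s i * c i) ^ 2
        + γ * (lam (Fin.castAdd q i) * c i)) ≤
      ∑ i, ((1 / 2) * (u (ρ (Fin.castAdd q i)) - w (ρ (Fin.castAdd q i))) ^ 2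
        + γ * (lam (Fin.castAdd q i) * (s i * w (ρ (Fin.castAdd q i))))) := by
    refine Finset.sum_le_sum fun i _ => ?_
    set a := u (ρ (Fin.castAdd q i))
    set b := w (ρ (Fin.castAdd q i))
    have h4 := hs i
    have h5 := hc i
    have h6 : γ * lam (Fin.castAdd q i) = s i * a - c i := by linarith
    have h7 : (1 / 2) * (a - b) ^ 2 + γ * (lam (Fin.castAdd q i) * (s i * b))
        - ((1 / 2) * (a - s i * c i) ^ 2 + γ * (lam (Fin.castAdd q i) * c i))
        = (1 / 2) * (b - s i * c i) ^ 2 := by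
      linear_combination (s i * b - c i) * h6 + (a * b - c i ^ 2) * h4
    nlinarith [sq_nonneg (b - s i * c i)]
  simp only [Finset.sum_add_distrib, ← Finset.mul_sum] at h3
  linarith

lemma eventually_mul_add_ge {a : ℝ} (ha : 0 < a) (b d : ℝ) : ∀ᶠ t : ℝ in atTop, d ≤ t * a + b :=
  (tendsto_atTop_add_const_right _ b (tendsto_id.atTop_mul_const ha)).eventually_ge_atTop d

lemma eventually_prox_eq_append (hlam : Antitone lam) (h0 : ∀ i, 0 ≤ lam i)
    {ρ : Equiv.Perm (Fin (k + q))} {s : Fin k → ℝ} (hs : ∀ i, s i ^ 2 = 1) {γ : ℝ} (hγ : 0 ≤ γ)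
    {x h : Fin (k + q) → ℝ} (hxpos : ∀ i, 0 < s i * x (ρ (Fin.castAdd q i)))
    (hxanti : StrictAnti fun i => s i * x (ρ (Fin.castAdd q i)))
    (hx0 : ∀ j, x (ρ (Fin.natAdd k j)) = 0) {W : Fin q → ℝ}
    (hW : IsSlopeProx (fun j => lam (Fin.natAdd k j)) γ (fun j => h (ρ (Fin.natAdd k j))) W)
    {η : (Fin (k + q) → ℝ) → Fin (k + q) → ℝ} (hη : ∀ u, IsSlopeProx lam γ u (η u)) :
    ∀ᶠ t : ℝ in atTop, ∑ i, (η (fun j => t * x j + h j) i - t * x i) ^ 2 =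
      ∑ i, (h (ρ (Fin.castAdd q i)) - γ * lam (Fin.castAdd q i) * s i) ^ 2 + ∑ j, W j ^ 2 := by
  set a : Fin k → ℝ := fun i => s i * x (ρ (Fin.castAdd q i)) with ha
  set b : Fin k → ℝ := fun i => s i * h (ρ (Fin.castAdd q i)) - γ * lam (Fin.castAdd q i) with hb
  have e1 : ∀ᶠ t : ℝ in atTop, ∀ i, 0 ≤ t * a i + b i :=
    eventually_all.2 fun i => eventually_mul_add_ge (hxpos i) _ _
  have e2 : ∀ᶠ t : ℝ in atTop, ∀ i j, i < j → t * a j + b j ≤ t * a i + b i := by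
    refine eventually_all.2 fun i => eventually_all.2 fun j => ?_
    by_cases hij : i < j
    · filter_upwards [eventually_mul_add_ge (sub_pos.2 (hxanti hij)) (b i - b j) 0] with t ht _
      linarith
    · exact Eventually.of_forall fun t h => absurd h hij
  have e3 : ∀ᶠ t : ℝ in atTop, ∀ i j, |W j| ≤ t * a i + b i :=
    eventually_all.2 fun i => eventually_all.2 fun j => eventually_mul_add_ge (hxpos i) _ _
  filter_upwards [e1, e2, e3] with t h1 h2 h3
  have hp := isSlopeProx_append (u := fun j => t * x j + h j) (W := W)
    (c := fun i => t * a i + b i) hlam h0 ρ hs hγ (by simpa [hx0] using hW)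
    (fun i => by simp only [ha, hb]; ring) h1 (antitone_iff_forall_lt.2 fun i j => h2 i j) h3
  rw [(hη _).eq hlam h0 hγ hp, ← Equiv.sum_comp ρ, Fin.sum_univ_add]
  simp only [Equiv.symm_apply_apply, Fin.append_left, Fin.append_right, hx0, mul_zero, sub_zero]
  congr 1
  refine Finset.sum_congr rfl fun i _ => ?_
  congr 1
  simp only [ha, hb]
  linear_combination (t * x (ρ (Fin.castAdd q i)) + h (ρ (Fin.castAdd q i))) * hs i

end Decoupling

section Gaussian

lemma measurePreserving_eval_stdGaussian {n : ℕ} (i : Fin n) :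
    MeasurePreserving (fun h : Fin n → ℝ => h i) (_root_.stdGaussian n) (gaussianReal 0 1) :=
  measurePreserving_eval (fun _ : Fin n => gaussianReal 0 1) i

lemma measurePreserving_comp_stdGaussian {m n : ℕ} {e : Fin m → Fin n} (he : e.Injective) :
    MeasurePreserving (fun (h : Fin n → ℝ) j => h (e j)) (_root_.stdGaussian n)
      (_root_.stdGaussian m) := by
  refine ⟨by fun_prop, ?_⟩
  have h1 : iIndepFun (fun i (h : Fin n → ℝ) => h i) (_root_.stdGaussian n) :=
    iIndepFun_pi (X := fun _ => id) fun _ => aemeasurable_id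
  have h2 := (iIndepFun_iff_map_fun_eq_pi_map fun i => (measurable_pi_apply _).aemeasurable).1 (h1.precomp he)
  refine h2.trans ?_
  simp only [(measurePreserving_eval_stdGaussian _).map_eq]
  rfl

lemma integrable_sub_sq_gaussianReal (c : ℝ) :
    Integrable (fun y : ℝ => (y - c) ^ 2) (gaussianReal 0 1) :=
  ((memLp_id_gaussianReal 2).sub (memLp_const c)).integrable_sq

lemma integral_sub_sq_gaussianReal (c : ℝ) :
    ∫ y, (y - c) ^ 2 ∂gaussianReal 0 1 = 1 + c ^ 2 := by
  have h2 : MemLp (fun y : ℝ => y) 2 (gaussianReal 0 1) := memLp_id_gaussianReal 2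
  have hsq : ∫ y, y ^ 2 ∂gaussianReal 0 1 = 1 := by
    have := variance_eq_sub h2
    rw [variance_fun_id_gaussianReal] at this
    simpa using this.symm
  have hi : Integrable (fun y : ℝ => y) (gaussianReal 0 1) := h2.integrable (by norm_num)
  have : ∀ y : ℝ, (y - c) ^ 2 = y ^ 2 - 2 * c * y + c ^ 2 := fun y => by ring
  simp only [this]
  rw [integral_add (f := fun y => y ^ 2 - 2 * c * y) (h2.integrable_sq.sub (hi.const_mul _))
      (integrable_const _),
    integral_sub h2.integrable_sq (hi.const_mul _), integral_const_mul, hsq,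
    integral_id_gaussianReal]
  simp

lemma integrable_eval_sub_sq_stdGaussian {n : ℕ} (i : Fin n) (c : ℝ) :
    Integrable (fun h : Fin n → ℝ => (h i - c) ^ 2) (_root_.stdGaussian n) :=
  (measurePreserving_eval_stdGaussian i).integrable_comp_of_integrable
    (integrable_sub_sq_gaussianReal c)

lemma integral_eval_sub_sq_stdGaussian {n : ℕ} (i : Fin n) (c : ℝ) :
    ∫ h, (h i - c) ^ 2 ∂_root_.stdGaussian n = 1 + c ^ 2 := by
  rw [← integral_sub_sq_gaussianReal c, ← (measurePreserving_eval_stdGaussian i).map_eq,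
    integral_map (measurable_pi_apply i).aemeasurable (by fun_prop)]

lemma integrable_sum_sq_stdGaussian (n : ℕ) :
    Integrable (fun h : Fin n → ℝ => ∑ i, h i ^ 2) (_root_.stdGaussian n) :=
  integrable_finsetSum _ fun i _ => by simpa using integrable_eval_sub_sq_stdGaussian i 0

lemma integral_sum_sq_stdGaussian (n : ℕ) :
    ∫ h, ∑ i, h i ^ 2 ∂_root_.stdGaussian n = n := by
  rw [integral_finsetSum _ fun i _ => by simpa using integrable_eval_sub_sq_stdGaussian i 0]
  have : ∀ i : Fin n, ∫ h, h i ^ 2 ∂_root_.stdGaussian n = 1 := fun i => by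
    simpa using integral_eval_sub_sq_stdGaussian i 0
  simp [this]

lemma sum_sq_le_two_mul_add {n : ℕ} (a b : Fin n → ℝ) :
    ∑ i, a i ^ 2 ≤ 2 * ∑ i, (b i - a i) ^ 2 + 2 * ∑ i, b i ^ 2 := by
  rw [Finset.mul_sum, Finset.mul_sum, ← Finset.sum_add_distrib]
  exact Finset.sum_le_sum fun i _ => by nlinarith [sq_nonneg (a i - 2 * b i)]

end Gaussian

section Risk

variable {n : ℕ} {lam : Fin n → ℝ} {η : ℝ → (Fin n → ℝ) → Fin n → ℝ}

lemma risk_integrand_le (hlam : Antitone lam) (h0 : ∀ i, 0 ≤ lam i)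
    (hη : ∀ γ u, 0 ≤ γ → IsSlopeProx lam γ u (η γ u)) {γ : ℝ} (hγ : 0 ≤ γ) (y h : Fin n → ℝ) :
    ∑ i, (η γ (fun j => y j + h j) i - y i) ^ 2 ≤
      2 * (γ ^ 2 * ∑ i, lam i ^ 2) + 2 * ∑ i, h i ^ 2 := by
  have h1 := sum_sq_le_two_mul_add (fun i => η γ (fun j => y j + h j) i - y i) h
  have h2 := (hη γ (fun j => y j + h j) hγ).sum_sq_residual_le hlam h0 hγ
  have h3 : ∑ i, (h i - (η γ (fun j => y j + h j) i - y i)) ^ 2 =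
      ∑ i, (y i + h i - η γ (fun j => y j + h j) i) ^ 2 :=
    Finset.sum_congr rfl fun i _ => by ring
  linarith

lemma continuous_risk_integrand (hlam : Antitone lam) (h0 : ∀ i, 0 ≤ lam i)
    (hη : ∀ γ u, 0 ≤ γ → IsSlopeProx lam γ u (η γ u)) {γ : ℝ} (hγ : 0 ≤ γ) (y : Fin n → ℝ) :
    Continuous fun h : Fin n → ℝ => ∑ i, (η γ (fun j => y j + h j) i - y i) ^ 2 := by
  have hc := continuous_of_isSlopeProx hlam h0 hγ fun u => hη γ u hγ
  fun_prop

lemma integrable_risk_integrand (hlam : Antitone lam) (h0 : ∀ i, 0 ≤ lam i)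
    (hη : ∀ γ u, 0 ≤ γ → IsSlopeProx lam γ u (η γ u)) {γ : ℝ} (hγ : 0 ≤ γ) (y : Fin n → ℝ) :
    Integrable (fun h : Fin n → ℝ => ∑ i, (η γ (fun j => y j + h j) i - y i) ^ 2)
      (_root_.stdGaussian n) := by
  refine Integrable.mono' ((integrable_const (2 * (γ ^ 2 * ∑ i, lam i ^ 2))).add
    ((integrable_sum_sq_stdGaussian n).const_mul 2))
    (continuous_risk_integrand hlam h0 hη hγ y).aestronglyMeasurable
    (Eventually.of_forall fun h => ?_)
  rw [Real.norm_of_nonneg (Finset.sum_nonneg fun i _ => sq_nonneg _)]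
  exact risk_integrand_le hlam h0 hη hγ y h

lemma risk_le_of_param (hlam : Antitone lam) (h0 : ∀ i, 0 ≤ lam i)
    (hη : ∀ γ u, 0 ≤ γ → IsSlopeProx lam γ u (η γ u)) {γ γ' ε : ℝ} (hγ : 0 ≤ γ) (hγ' : 0 ≤ γ')
    (hε : 0 < ε) (y : Fin n → ℝ) :
    ∫ h, ∑ i, (η γ' (fun j => y j + h j) i - y i) ^ 2 ∂_root_.stdGaussian n ≤
      (1 + ε) * ∫ h, ∑ i, (η γ (fun j => y j + h j) i - y i) ^ 2 ∂_root_.stdGaussian n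
        + (1 + 1 / ε) * ((γ - γ') ^ 2 * ∑ i, lam i ^ 2) := by
  have hi := integrable_risk_integrand hlam h0 hη hγ y
  calc _ ≤ ∫ h, ((1 + ε) * ∑ i, (η γ (fun j => y j + h j) i - y i) ^ 2
        + (1 + 1 / ε) * ((γ - γ') ^ 2 * ∑ i, lam i ^ 2)) ∂_root_.stdGaussian n := by
        refine integral_mono (integrable_risk_integrand hlam h0 hη hγ' y)
          ((hi.const_mul _).add (integrable_const _)) fun h => ?_
        set u := fun j => y j + h j
        have h1 := (hη γ u hγ).sum_sq_sub_le_param hlam h0 hγ hγ' (hη γ' u hγ')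
        refine le_trans ?_ (add_le_add le_rfl (mul_le_mul_of_nonneg_left h1 (by positivity)))
        rw [Finset.mul_sum, Finset.mul_sum, ← Finset.sum_add_distrib]
        refine Finset.sum_le_sum fun i _ => ?_
        set a := η γ u i - y i with ha
        set b := η γ u i - η γ' u i with hb
        have h2 : η γ' u i - y i = a - b := by rw [ha, hb]; ring
        have h3 : (1 + ε) * a ^ 2 + (1 + 1 / ε) * b ^ 2 - (a - b) ^ 2 = (ε * a + b) ^ 2 / ε := by
          field_simp
          ring
        have h4 : 0 ≤ (ε * a + b) ^ 2 / ε := by positivity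
        rw [h2]
        linarith
    _ = _ := by
      rw [integral_add (hi.const_mul _) (integrable_const _), integral_const_mul]
      simp

lemma risk_le_of_lt (hlam : Antitone lam) (h0 : ∀ i, 0 ≤ lam i)
    (hη : ∀ γ u, 0 ≤ γ → IsSlopeProx lam γ u (η γ u)) {γ γ' : ℝ} (hγ : 0 ≤ γ) (hγ' : γ < γ')
    (y : Fin n → ℝ) :
    ∫ h, ∑ i, (η γ (fun j => y j + h j) i - y i) ^ 2 ∂_root_.stdGaussian n ≤
      6 * n + 4 * ∫ h, ∑ i, (η γ' (fun j => y j + h j) i - y i) ^ 2 ∂_root_.stdGaussian n := by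
  have hi := integrable_risk_integrand hlam h0 hη (hγ.trans hγ'.le) y
  have hs := integrable_sum_sq_stdGaussian n
  calc _ ≤ ∫ h, (6 * ∑ i, h i ^ 2 + 4 * ∑ i, (η γ' (fun j => y j + h j) i - y i) ^ 2)
        ∂_root_.stdGaussian n := by
        refine integral_mono (integrable_risk_integrand hlam h0 hη hγ y)
          ((hs.const_mul _).add (hi.const_mul _)) fun h => ?_
        set u := fun j => y j + h j with hu
        have h1 := (hη γ u hγ).sum_sq_residual_mono hγ hγ' (hη γ' u (hγ.trans hγ'.le))
        have h2 := sum_sq_le_two_mul_add (fun i => η γ u i - y i) h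
        have h3 := sum_sq_le_two_mul_add (fun i => u i - η γ' u i) h
        have e : ∀ γ i, h i - (η γ u i - y i) = u i - η γ u i := fun γ i => by
          simp only [hu]; ring
        have e' : ∀ i, h i - (u i - η γ' u i) = η γ' u i - y i := fun i => by
          simp only [hu]; ring
        simp only [e] at h2
        simp only [e'] at h3
        linarith
    _ = _ := by
      rw [integral_add (hs.const_mul _) (hi.const_mul _), integral_const_mul, integral_const_mul,
        integral_sum_sq_stdGaussian]

end Risk

lemma integrable_sum_sq_prox {n : ℕ} {lam : Fin n → ℝ} (hlam : Antitone lam)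
    (h0 : ∀ i, 0 ≤ lam i) {f : (Fin n → ℝ) → Fin n → ℝ} {γ : ℝ} (hγ : 0 ≤ γ)
    (hf : ∀ u, IsSlopeProx lam γ u (f u)) :
    Integrable (fun h => ∑ i, f h i ^ 2) (_root_.stdGaussian n) := by
  have hc := continuous_of_isSlopeProx hlam h0 hγ hf
  refine Integrable.mono' ((integrable_const (2 * (γ ^ 2 * ∑ i, lam i ^ 2))).add
    ((integrable_sum_sq_stdGaussian n).const_mul 2))
    (by fun_prop : Continuous fun h => ∑ i, f h i ^ 2).aestronglyMeasurable
    (Eventually.of_forall fun h => ?_)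
  rw [Real.norm_of_nonneg (Finset.sum_nonneg fun i _ => sq_nonneg _)]
  have h1 := (hf h).sum_sq_residual_le hlam h0 hγ
  have h2 := sum_sq_le_two_mul_add (f h) h
  simp only [Pi.add_apply]
  linarith

section Limit

variable {k q : ℕ} {lam : Fin (k + q) → ℝ}

lemma tendsto_risk_atTop (hlam : Antitone lam) (h0 : ∀ i, 0 ≤ lam i)
    {ρ : Equiv.Perm (Fin (k + q))} {s : Fin k → ℝ} (hs : ∀ i, s i ^ 2 = 1) {γ : ℝ} (hγ : 0 ≤ γ)
    {x : Fin (k + q) → ℝ} (hxpos : ∀ i, 0 < s i * x (ρ (Fin.castAdd q i)))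
    (hxanti : StrictAnti fun i => s i * x (ρ (Fin.castAdd q i)))
    (hx0 : ∀ j, x (ρ (Fin.natAdd k j)) = 0)
    {η : ℝ → (Fin (k + q) → ℝ) → Fin (k + q) → ℝ}
    (hη : ∀ γ u, 0 ≤ γ → IsSlopeProx lam γ u (η γ u))
    {ηq : ℝ → (Fin q → ℝ) → Fin q → ℝ}
    (hηq : ∀ γ u, 0 ≤ γ → IsSlopeProx (fun j => lam (Fin.natAdd k j)) γ u (ηq γ u)) :
    Tendsto (fun t : ℝ => ∫ h, ∑ i, (η γ (fun j => t * x j + h j) i - t * x i) ^ 2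
        ∂_root_.stdGaussian (k + q)) atTop
      (nhds (k + γ ^ 2 * ∑ i, lam (Fin.castAdd q i) ^ 2
        + ∫ h, ∑ j, ηq γ h j ^ 2 ∂_root_.stdGaussian q)) := by
  have hlamq : Antitone fun j => lam (Fin.natAdd k j) := fun i j hij =>
    hlam (by simpa using hij)
  have hiq := integrable_sum_sq_prox hlamq (fun _ => h0 _) hγ fun u => hηq γ u hγ
  have hmp := measurePreserving_comp_stdGaussian (e := fun j => ρ (Fin.natAdd k j))
    (ρ.injective.comp (Fin.natAdd_injective q k))
  have hiq' : Integrable (fun h : Fin (k + q) → ℝ =>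
      ∑ j, ηq γ (fun j => h (ρ (Fin.natAdd k j))) j ^ 2) (_root_.stdGaussian (k + q)) :=
    hmp.integrable_comp_of_integrable hiq
  have hval : ∫ h, (∑ i, (h (ρ (Fin.castAdd q i)) - γ * lam (Fin.castAdd q i) * s i) ^ 2
        + ∑ j, ηq γ (fun j => h (ρ (Fin.natAdd k j))) j ^ 2) ∂_root_.stdGaussian (k + q) =
      k + γ ^ 2 * ∑ i, lam (Fin.castAdd q i) ^ 2
        + ∫ h, ∑ j, ηq γ h j ^ 2 ∂_root_.stdGaussian q := by
    rw [integral_add (integrable_finsetSum _ fun i _ => integrable_eval_sub_sq_stdGaussian _ _)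
        hiq',
      integral_finsetSum _ fun i _ => integrable_eval_sub_sq_stdGaussian _ _]
    congr 1
    · simp only [integral_eval_sub_sq_stdGaussian, mul_pow, hs, Finset.sum_add_distrib,
        Finset.mul_sum]
      simp
    · rw [← hmp.map_eq, integral_map hmp.aemeasurable]
      rw [hmp.map_eq]
      exact hiq.aestronglyMeasurable
  rw [← hval]
  refine tendsto_integral_filter_of_dominated_convergence
    (fun h => 2 * (γ ^ 2 * ∑ i, lam i ^ 2) + 2 * ∑ i, h i ^ 2)
    (Eventually.of_forall fun t =>
      (continuous_risk_integrand hlam h0 hη hγ fun j => t * x j).aestronglyMeasurable)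
    (Eventually.of_forall fun t => Eventually.of_forall fun h => ?_)
    ((integrable_const _).add ((integrable_sum_sq_stdGaussian _).const_mul 2))
    (Eventually.of_forall fun h => ?_)
  · rw [Real.norm_of_nonneg (Finset.sum_nonneg fun i _ => sq_nonneg _)]
    exact risk_integrand_le hlam h0 hη hγ (fun j => t * x j) h
  · exact tendsto_const_nhds.congr' ((eventually_prox_eq_append hlam h0 hs hγ hxpos hxanti hx0
      (hηq γ _ hγ) fun u => hη γ u hγ).mono fun t ht => ht.symm)

/-- Convergence of infima over `(0, ∞)` for a family that converges pointwise, is locally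
equicontinuous in the parameter, and is coercive. -/
lemma tendsto_sInf_of_coercive {F : ℝ → ℝ → ℝ} {G : ℝ → ℝ} {K L c : ℝ} (hL : 0 ≤ L) (hc : 0 < c)
    (hF0 : ∀ t χ, 0 ≤ F t χ) (hFG : ∀ χ, 0 < χ → Tendsto (fun t => F t χ) atTop (nhds (G χ)))
    (hcont : ∀ t χ χ' ε, 0 < χ → 0 < χ' → 0 < ε →
      F t χ' ≤ (1 + ε) * F t χ + (1 + 1 / ε) * ((χ - χ') ^ 2 * L))
    (hmono : ∀ t χ χ', 0 < χ → χ < χ' → F t χ ≤ K + 4 * F t χ')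
    (hG : ∀ χ, 0 < χ → c * χ ^ 2 ≤ G χ) :
    Tendsto (fun t => sInf {m | ∃ χ, 0 < χ ∧ m = F t χ}) atTop
      (nhds (sInf {m | ∃ χ, 0 < χ ∧ m = G χ})) := by
  set m := sInf {m | ∃ χ, 0 < χ ∧ m = G χ} with hm
  have hbG : BddBelow {m | ∃ χ, 0 < χ ∧ m = G χ} :=
    ⟨0, by rintro _ ⟨χ, hχ, rfl⟩; exact (by positivity : 0 ≤ c * χ ^ 2).trans (hG χ hχ)⟩
  have hmG : ∀ χ, 0 < χ → m ≤ G χ := fun χ hχ => csInf_le hbG ⟨χ, hχ, rfl⟩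
  have hbF : ∀ t, BddBelow {m | ∃ χ, 0 < χ ∧ m = F t χ} := fun t =>
    ⟨0, by rintro _ ⟨χ, -, rfl⟩; exact hF0 t χ⟩
  refine tendsto_order.2 ⟨fun a' ha' => ?_, fun a ha => ?_⟩
  · obtain ⟨a, haa, ham⟩ := exists_between ha'
    suffices h : ∀ᶠ t in atTop, ∀ χ, 0 < χ → a ≤ F t χ by
      filter_upwards [h] with t ht
      refine haa.trans_le (le_csInf ⟨_, 1, one_pos, rfl⟩ ?_)
      rintro _ ⟨χ, hχ, rfl⟩
      exact ht χ hχ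
    rcases lt_or_ge a 0 with ha0 | ha0
    · exact Eventually.of_forall fun t χ _ => ha0.le.trans (hF0 t χ)
    obtain ⟨b, hab, hbm⟩ := exists_between ham
    obtain ⟨C, hC0, hC⟩ : ∃ C, 0 < C ∧ K + 4 * a < c * C ^ 2 := by
      have : Tendsto (fun C : ℝ => c * C ^ 2) atTop atTop :=
        (tendsto_pow_atTop two_ne_zero).const_mul_atTop hc
      exact ((eventually_gt_atTop 0).and (this.eventually_gt_atTop _)).exists
    obtain ⟨ε, hε0, hε⟩ : ∃ ε, 0 < ε ∧ ε * a < (b - a) / 2 := by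
      refine ⟨(b - a) / 2 / (a + 1), by have := sub_pos.2 hab; positivity, ?_⟩
      rw [div_mul_eq_mul_div, div_lt_iff₀ (by linarith)]
      nlinarith
    obtain ⟨δ, hδ0, hδ⟩ : ∃ δ : ℝ, 0 < δ ∧ (1 + 1 / ε) * (δ ^ 2 * L) < (b - a) / 2 := by
      have h1 : Tendsto (fun δ : ℝ => (1 + 1 / ε) * (δ ^ 2 * L)) (nhdsWithin 0 (Set.Ioi 0))
          (nhds 0) := by
        have : Continuous fun δ : ℝ => (1 + 1 / ε) * (δ ^ 2 * L) := by fun_prop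
        simpa using (this.tendsto 0).mono_left nhdsWithin_le_nhds
      have h2 : ∀ᶠ δ : ℝ in nhdsWithin 0 (Set.Ioi 0), 0 < δ := self_mem_nhdsWithin
      exact (h2.and (h1.eventually_lt_const (by linarith : 0 < (b - a) / 2))).exists
    have e1 : ∀ᶠ t in atTop, ∀ j ∈ Finset.Icc 1 ⌈C / δ⌉₊, b < F t (δ * j) := by
      refine (eventually_all_finset _).2 fun j hj => ?_
      have hj0 : 0 < δ * (j : ℝ) :=
        mul_pos hδ0 (Nat.cast_pos.2 (Finset.mem_Icc.1 hj).1)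
      exact (hFG _ hj0).eventually_const_lt (hbm.trans_le (hmG _ hj0))
    have e2 : ∀ᶠ t in atTop, K + 4 * a < F t C :=
      (hFG C hC0).eventually_const_lt (hC.trans_le (hG C hC0))
    filter_upwards [e1, e2] with t h1 h2 χ hχ
    rcases lt_or_ge C χ with hCχ | hCχ
    · linarith [hmono t C χ hC0 hCχ]
    · by_contra! hlt
      set j := ⌈χ / δ⌉₊ with hj
      have hχδ : 0 < χ / δ := div_pos hχ hδ0
      have hj1 : 1 ≤ j := Nat.ceil_pos.2 hχδ
      have hjC : j ≤ ⌈C / δ⌉₊ := Nat.ceil_mono (by gcongr)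
      have h3 := h1 j (Finset.mem_Icc.2 ⟨hj1, hjC⟩)
      have h4 := hcont t χ (δ * j) ε hχ (mul_pos hδ0 (Nat.cast_pos.2 hj1)) hε0
      have h5 : χ ≤ δ * j := by
        have := Nat.le_ceil (χ / δ)
        rw [div_le_iff₀ hδ0] at this
        linarith
      have h6 : δ * j ≤ χ + δ := by
        have := Nat.ceil_lt_add_one hχδ.le
        have := mul_lt_mul_of_pos_left this hδ0
        rw [mul_add, mul_div_cancel₀ _ hδ0.ne', mul_one] at this
        exact this.le
      have h7 : (χ - δ * j) ^ 2 ≤ δ ^ 2 := sq_le_sq' (by linarith) (by linarith)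
      have h8 : (1 + 1 / ε) * ((χ - δ * j) ^ 2 * L) ≤ (1 + 1 / ε) * (δ ^ 2 * L) := by gcongr
      have h9 : (1 + ε) * F t χ ≤ (1 + ε) * a := by gcongr
      linarith
  · obtain ⟨_, ⟨χ, hχ, rfl⟩, hlt⟩ := exists_lt_of_csInf_lt
      (⟨G 1, 1, one_pos, rfl⟩ : {m | ∃ χ, 0 < χ ∧ m = G χ}.Nonempty) ha
    filter_upwards [(hFG χ hχ).eventually_lt_const hlt] with t ht
    exact (csInf_le (hbF t) ⟨χ, hχ, rfl⟩).trans_lt ht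

end Limit

section Support

variable {k q : ℕ} {x : Fin (k + q) → ℝ}

lemma card_ne_zero_comp_perm (hxk : {i | x i ≠ 0}.ncard = k) (ρ : Equiv.Perm (Fin (k + q))) :
    (Finset.univ.filter fun i => x (ρ i) ≠ 0).card = k := by
  refine Eq.trans ?_ hxk
  rw [← Set.ncard_coe_finset]
  have : {i | x i ≠ 0} = ρ '' {i | x (ρ i) ≠ 0} := by
    ext i
    simp only [Set.mem_ofPred_eq, Set.mem_image]
    exact ⟨fun h => ⟨ρ.symm i, by simpa using h, by simp⟩, by rintro ⟨j, hj, rfl⟩; exact hj⟩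
  rw [this, Set.ncard_image_of_injective _ ρ.injective]
  simp

lemma apply_perm_natAdd_eq_zero (hxk : {i | x i ≠ 0}.ncard = k) {ρ : Equiv.Perm (Fin (k + q))}
    (hρ : Antitone fun i => |x (ρ i)|) (j : Fin q) : x (ρ (Fin.natAdd k j)) = 0 := by
  by_contra h
  have hsub : Finset.Iic (Fin.natAdd k j) ⊆ Finset.univ.filter fun i => x (ρ i) ≠ 0 := by
    intro i hi
    have h1 := hρ (Finset.mem_Iic.1 hi)
    simpa using (abs_pos.2 h).trans_le h1
  have := Finset.card_le_card hsub
  rw [card_ne_zero_comp_perm hxk, Fin.card_Iic, Fin.val_natAdd] at this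
  omega

lemma apply_perm_castAdd_ne_zero (hxk : {i | x i ≠ 0}.ncard = k) {ρ : Equiv.Perm (Fin (k + q))}
    (hρ : Antitone fun i => |x (ρ i)|) (i : Fin k) : x (ρ (Fin.castAdd q i)) ≠ 0 := by
  intro h
  have hsub : (Finset.univ.filter fun i => x (ρ i) ≠ 0) ⊆ Finset.Iio (Fin.castAdd q i) := by
    intro j hj
    rw [Finset.mem_Iio]
    by_contra! hij
    have h1 : |x (ρ j)| ≤ |x (ρ (Fin.castAdd q i))| := hρ hij
    rw [h, abs_zero] at h1
    exact (Finset.mem_filter.1 hj).2 (abs_nonpos_iff.1 h1)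
  have := Finset.card_le_card hsub
  rw [card_ne_zero_comp_perm hxk, Fin.card_Iio, Fin.val_castAdd] at this
  omega

end Support

/-- The optimal risk at signal strength `t` converges as `t → ∞`. -/
lemma tendsto_optimal_risk_atTop {k q : ℕ} {lam : Fin (k + q) → ℝ} (hk : 0 < k)
    (hlam : Antitone lam) (h0 : ∀ i, 0 ≤ lam i) (hlam1 : 0 < lam (Fin.castAdd q ⟨0, hk⟩))
    {x : Fin (k + q) → ℝ} (hxk : {i | x i ≠ 0}.ncard = k)
    (hdistinct : ∀ i j, i ≠ j → x i ≠ 0 → x j ≠ 0 → |x i| ≠ |x j|)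
    {η : ℝ → (Fin (k + q) → ℝ) → Fin (k + q) → ℝ}
    (hη : ∀ γ u, 0 ≤ γ → IsSlopeProx lam γ u (η γ u))
    {ηq : ℝ → (Fin q → ℝ) → Fin q → ℝ}
    (hηq : ∀ γ u, 0 ≤ γ → IsSlopeProx (fun j => lam (Fin.natAdd k j)) γ u (ηq γ u)) :
    Tendsto (fun t : ℝ => sInf {m : ℝ | ∃ χ : ℝ, 0 < χ ∧
        m = ∫ h, ∑ i, (η χ (fun j => t * x j + h j) i - t * x i) ^ 2
          ∂_root_.stdGaussian (k + q)}) atTop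
      (nhds (sInf {m : ℝ | ∃ α : ℝ, 0 < α ∧ m = k + α ^ 2 * ∑ i, lam (Fin.castAdd q i) ^ 2
        + ∫ h, ∑ j, ηq α h j ^ 2 ∂_root_.stdGaussian q})) := by
  set ρ : Equiv.Perm (Fin (k + q)) := Tuple.sort fun j => -|x j|
  have hρ : Antitone fun i => |x (ρ i)| := antitone_sortedAbs x
  have hne := apply_perm_castAdd_ne_zero hxk hρ
  choose s hs hsx using fun i : Fin k =>
    (show ∃ s : ℝ, s ^ 2 = 1 ∧ s * x (ρ (Fin.castAdd q i)) = |x (ρ (Fin.castAdd q i))| by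
      rcases abs_choice (x (ρ (Fin.castAdd q i))) with h | h
      · exact ⟨1, by norm_num, by rw [h, one_mul]⟩
      · exact ⟨-1, by norm_num, by rw [h, neg_one_mul]⟩)
  have hanti : StrictAnti fun i => s i * x (ρ (Fin.castAdd q i)) := by
    intro i j hij
    have h1 : Fin.castAdd q i < Fin.castAdd q j := hij
    simp only [hsx]
    exact lt_of_le_of_ne (hρ h1.le)
      (hdistinct _ _ (ρ.injective.ne h1.ne') (hne j) (hne i))
  refine tendsto_sInf_of_coercive (K := 6 * ((k + q : ℕ) : ℝ)) (L := ∑ i, lam i ^ 2)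
    (c := lam (Fin.castAdd q ⟨0, hk⟩) ^ 2)
    (F := fun t χ => ∫ h, ∑ i, (η χ (fun j => t * x j + h j) i - t * x i) ^ 2
          ∂_root_.stdGaussian (k + q))
    (G := fun α => k + α ^ 2 * ∑ i, lam (Fin.castAdd q i) ^ 2
        + ∫ h, ∑ j, ηq α h j ^ 2 ∂_root_.stdGaussian q)
    (Finset.sum_nonneg fun i _ => sq_nonneg _) (by positivity)
    (fun t χ => integral_nonneg fun h => Finset.sum_nonneg fun i _ => sq_nonneg _)
    (fun χ hχ => tendsto_risk_atTop hlam h0 hs hχ.le (fun i => by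
      rw [hsx]; exact abs_pos.2 (hne i)) hanti (apply_perm_natAdd_eq_zero hxk hρ) hη hηq)
    (fun t χ χ' ε hχ hχ' hε => risk_le_of_param hlam h0 hη hχ.le hχ'.le hε fun j => t * x j)
    (fun t χ χ' hχ hχ' => risk_le_of_lt hlam h0 hη hχ.le hχ' fun j => t * x j)
    (fun χ hχ => ?_)
  have h1 : lam (Fin.castAdd q ⟨0, hk⟩) ^ 2 ≤ ∑ i, lam (Fin.castAdd q i) ^ 2 :=
    Finset.single_le_sum (f := fun i => lam (Fin.castAdd q i) ^ 2) (fun i _ => sq_nonneg _)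
      (Finset.mem_univ _)
  have h2 : 0 ≤ ∫ h, ∑ j, ηq χ h j ^ 2 ∂_root_.stdGaussian q :=
    integral_nonneg fun h => Finset.sum_nonneg fun i _ => sq_nonneg _
  have h3 := mul_le_mul_of_nonneg_left h1 (sq_nonneg χ)
  have h4 : (0 : ℝ) ≤ k := k.cast_nonneg
  linarith

/-- `lim_{v → 0⁺} (1/p) inf_{χ>0} E‖η(x/√v + h; χ) − x/√v‖₂² = M_λ`. -/
theorem slope_optimal_mse_limit_eq_M
    (p k : ℕ) (hp : 1 ≤ p) (hk1 : 1 ≤ k) (hkp : k ≤ p)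
    (lam : Fin p → ℝ)
    (hmono : ∀ i j : Fin p, i ≤ j → lam j ≤ lam i)
    (hnonneg : ∀ i, 0 ≤ lam i)
    (hlam1 : 0 < lam ⟨0, hp⟩)
    (x : Fin p → ℝ)
    (hxk : {i : Fin p | x i ≠ 0}.ncard = k)
    (hdistinct : ∀ i j : Fin p, i ≠ j → x i ≠ 0 → x j ≠ 0 → |x i| ≠ |x j|)
    (η : ℝ → (Fin p → ℝ) → (Fin p → ℝ))
    (hη : ∀ γ u, 0 ≤ γ → IsSlopeProx lam γ u (η γ u))
    (lamq : Fin (p - k) → ℝ)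
    (hlamq : ∀ i : Fin (p - k), lamq i = lam ⟨k + i.val, by have := i.isLt; omega⟩)
    (ηq : ℝ → (Fin (p - k) → ℝ) → (Fin (p - k) → ℝ))
    (hηq : ∀ γ u, 0 ≤ γ → IsSlopeProx lamq γ u (ηq γ u))
    (M : ℝ)
    (hM : M = (1 / (p : ℝ)) * sInf {m : ℝ | ∃ α : ℝ, 0 < α ∧
      m = (k : ℝ) + α ^ 2 * (∑ i : Fin p, if (i : ℕ) < k then lam i ^ 2 else 0)
        + ∫ ht, (∑ i, (ηq α ht i) ^ 2) ∂ stdGaussian (p - k)}) :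
    Filter.Tendsto (fun v : ℝ => (1 / (p : ℝ)) * sInf {m : ℝ | ∃ χ : ℝ, 0 < χ ∧
        m = ∫ h, (∑ i,
          (η χ (fun j => x j / Real.sqrt v + h j) i - x i / Real.sqrt v) ^ 2)
          ∂ stdGaussian p})
      (nhdsWithin 0 (Set.Ioi 0)) (nhds M) := by
  have hlamq' : ∀ (i : Fin (p - k)) (h : k + i.val < p), lamq i = lam ⟨k + i.val, h⟩ :=
    fun i _ => hlamq i
  clear hlamq
  obtain ⟨q, hq⟩ : ∃ q, p - k = q := ⟨_, rfl⟩
  obtain rfl : p = k + q := by omega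
  generalize k + q - k = q' at *
  subst hq
  obtain rfl : lamq = fun j => lam (Fin.natAdd k j) :=
    funext fun i => hlamq' i (Fin.natAdd k i).isLt
  have hsum : (∑ i : Fin (k + q'), if (i : ℕ) < k then lam i ^ 2 else 0) =
      ∑ i : Fin k, lam (Fin.castAdd q' i) ^ 2 := by
    simp [Fin.sum_univ_add]
  rw [hM, hsum]
  have ht : Tendsto (fun v : ℝ => (√v)⁻¹) (nhdsWithin 0 (Set.Ioi 0)) atTop := by
    refine tendsto_inv_nhdsGT_zero.comp (tendsto_nhdsWithin_iff.2 ⟨?_, ?_⟩)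
    · simpa using (Real.continuous_sqrt.tendsto 0).mono_left nhdsWithin_le_nhds
    · exact eventually_nhdsWithin_of_forall fun v hv => Real.sqrt_pos.2 hv
  have h := (tendsto_optimal_risk_atTop hk1 (fun i j hij => hmono i j hij) hnonneg hlam1 hxk
    hdistinct hη hηq).comp ht
  refine (h.const_mul (1 / ((k + q' : ℕ) : ℝ))).congr fun v => ?_
  simp only [Function.comp_apply, div_eq_inv_mul]
end
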